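/- Define the multi-measurement of the three qubit mutually unbiased bases: for y ∈ {1,2,3} and b ∈ {0,1}, M_{b|y} := (1/2)(1 + (−1)^b • σ_{(y)}), where σ_{(1)} = σx, σ_{(2)} = σy, σ_{(3)} = σz. For η ∈ [0,1] define M^η_{b|y} := η • M_{b|y} + (1−η) • (1/2) • 1. Then the multi-measurement (M^η_{b|y}) on ℂ² is classical if and only if η ≤ 1/√3; i.e. the white-noise robustness of the set of measurements in the three qubit mutually unbiased bases equals √3/3. -/

import Mathlib

open Matrix BigOperators
open scoped ComplexOrder

noncomputable section

def σx : Matrix (Fin 2) (Fin 2) ℂ := !![0, 1; 1, 0]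
def σy : Matrix (Fin 2) (Fin 2) ℂ := !![0, -Complex.I; Complex.I, 0]
def σz : Matrix (Fin 2) (Fin 2) ℂ := !![1, 0; 0, -1]

/-- The noncontextual measurement-assignment polytope of a multi-measurement. -/
def multiPolytope {d : ℕ} {B Y : Type*} [Fintype B] [Fintype Y]
    (M : B × Y → Matrix (Fin d) (Fin d) ℂ) : Set (B × Y → ℝ) :=
  {q | (∀ p, 0 ≤ q p) ∧ (∀ y : Y, ∑ b : B, q (b, y) = 1) ∧
    ∀ β : B × Y → ℝ, (∑ p : B × Y, β p • M p = 0) → (∑ p : B × Y, β p * q p = 0)}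

/-- A multi-measurement is classical. -/
def IsClassicalMulti {d : ℕ} {B Y : Type*} [Fintype B] [Fintype Y]
    (M : B × Y → Matrix (Fin d) (Fin d) ℂ) : Prop :=
  ∃ (n : ℕ) (G : Fin n → Matrix (Fin d) (Fin d) ℂ) (q : Fin n → B × Y → ℝ),
    (∀ l, (G l).PosSemidef) ∧ (∑ l, G l = 1) ∧
    (∀ l, q l ∈ multiPolytope M) ∧
    (∀ b : B, ∀ y : Y, M (b, y) = ∑ l, q l (b, y) • G l)

/-- The multi-measurement of the three qubit mutually unbiased bases:
`M (b, y) = (1/2)(1 + (−1)^b σ_y)` with `σ_1 = σx`, `σ_2 = σy`, `σ_3 = σz`. -/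
def mub3 : Fin 2 × Fin 3 → Matrix (Fin 2) (Fin 2) ℂ :=
  fun p => (2 : ℝ)⁻¹ •
    ((1 : Matrix (Fin 2) (Fin 2) ℂ) + ((-1 : ℝ) ^ (p.1 : ℕ)) • ![σx, σy, σz] p.2)

def WS (a b c : ℝ) : Matrix (Fin 2) (Fin 2) ℂ :=
  !![(c : ℂ), a - b * Complex.I; a + b * Complex.I, -(c : ℂ)]

lemma WS_herm (r a b c : ℝ) : ((r : ℂ) • (1 : Matrix (Fin 2) (Fin 2) ℂ) + WS a b c)ᴴ =
    (r : ℂ) • (1 : Matrix (Fin 2) (Fin 2) ℂ) + WS a b c := by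
  ext i j
  fin_cases i <;> fin_cases j <;> simp [WS, Matrix.conjTranspose_apply, Complex.ext_iff]

lemma WS_sq (r a b c : ℝ) (ha : a ^ 2 = 1) (hb : b ^ 2 = 1) (hc : c ^ 2 = 1) :
    ((r : ℂ) • (1 : Matrix (Fin 2) (Fin 2) ℂ) + WS a b c) *
      ((r : ℂ) • (1 : Matrix (Fin 2) (Fin 2) ℂ) + WS a b c) =
    (r ^ 2 + 3 : ℝ) • (1 : Matrix (Fin 2) (Fin 2) ℂ) + (2 * r : ℝ) • WS a b c := by
  ext i j
  fin_cases i <;> fin_cases j <;>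
    simp [WS, Matrix.mul_apply, Fin.sum_univ_two, Complex.ext_iff, -Complex.ofReal_pow,
      ← Complex.ofReal_pow] <;> first | done | (constructor <;> nlinarith) | nlinarith

lemma G_psd (η a b c : ℝ) (h0 : 0 ≤ η) (h : η * Real.sqrt 3 ≤ 1) (ha : a ^ 2 = 1) (hb : b ^ 2 = 1)
    (hc : c ^ 2 = 1) :
    ((8 : ℝ)⁻¹ • ((1 : Matrix (Fin 2) (Fin 2) ℂ) + η • WS a b c)).PosSemidef := by
  have h3 : Real.sqrt 3 ^ 2 = 3 := Real.sq_sqrt (by norm_num)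
  have hp : 0 ≤ η * Real.sqrt 3 := by positivity
  have key : ∀ r : ℝ, r ^ 2 = 3 →
      ((6 : ℝ) • (1 : Matrix (Fin 2) (Fin 2) ℂ) + (2 * r : ℝ) • WS a b c).PosSemidef := by
    intro r hr
    have := Matrix.posSemidef_self_mul_conjTranspose
      ((r : ℂ) • (1 : Matrix (Fin 2) (Fin 2) ℂ) + WS a b c)
    rw [WS_herm, WS_sq r a b c ha hb hc, hr] at this
    norm_num at this ⊢
    exact this
  have e : ((8 : ℝ)⁻¹ • ((1 : Matrix (Fin 2) (Fin 2) ℂ) + η • WS a b c)) =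
      ((1 + η * Real.sqrt 3) / 96) • ((6 : ℝ) • (1 : Matrix (Fin 2) (Fin 2) ℂ)
        + (2 * Real.sqrt 3 : ℝ) • WS a b c) +
      ((1 - η * Real.sqrt 3) / 96) • ((6 : ℝ) • (1 : Matrix (Fin 2) (Fin 2) ℂ)
        + (2 * (-Real.sqrt 3) : ℝ) • WS a b c) := by
    match_scalars
    · ring
    · linear_combination (-η / 24) * h3
  rw [e]
  exact ((key _ h3).smul (by linarith)).add ((key _ (by rw [neg_sq, h3])).smul (by linarith))

lemma psd_bound (G : Matrix (Fin 2) (Fin 2) ℂ) (hG : G.PosSemidef) (a b c : ℝ)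
    (ha : |a| ≤ 1) (hb : |b| ≤ 1) (hc : |c| ≤ 1) :
    a * (G 0 1 + G 1 0).re + b * (G 1 0 - G 0 1).im + c * (G 0 0 - G 1 1).re ≤
      Real.sqrt 3 * (G 0 0 + G 1 1).re := by
  have h3 : Real.sqrt 3 ^ 2 = 3 := Real.sq_sqrt (by norm_num)
  have hd := hG.det_nonneg
  have h0 := hG.diag_nonneg (i := 0)
  have h1 := hG.diag_nonneg (i := 1)
  have h01 : G 0 1 = star (G 1 0) := (hG.isHermitian.apply 0 1).symm
  rw [Matrix.det_fin_two, h01] at hd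
  rw [h01]
  rw [Complex.le_def] at hd h0 h1
  obtain ⟨h0, h0'⟩ := h0
  obtain ⟨h1, h1'⟩ := h1
  have hd := hd.1
  simp at hd h0 h1 h0' h1' ⊢
  rw [← h0', ← h1'] at hd
  generalize (G 0 0).re = p at *
  generalize (G 1 1).re = q at *
  generalize (G 1 0).re = x at *
  generalize (G 1 0).im = y at *
  rw [← sq_le_one_iff_abs_le_one] at ha hb hc
  refine (le_abs_self _).trans (abs_le_of_sq_le_sq ?_ (by positivity))
  rw [mul_pow, h3]
  have hcs : (a * (x + x) + b * (y + y) + c * (p - q)) ^ 2 ≤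
     (a ^ 2 + b ^ 2 + c ^ 2) * ((x + x) ^ 2 + (y + y) ^ 2 + (p - q) ^ 2) := by
    nlinarith [sq_nonneg (a * (y + y) - b * (x + x)), sq_nonneg (a * (p - q) - c * (x + x)),
      sq_nonneg (b * (p - q) - c * (y + y))]
  have : (a ^ 2 + b ^ 2 + c ^ 2) * ((x + x) ^ 2 + (y + y) ^ 2 + (p - q) ^ 2) ≤
     3 * ((x + x) ^ 2 + (y + y) ^ 2 + (p - q) ^ 2) := by
    gcongr; linarith
  nlinarith

def detq (a b c : ℝ) : Fin 2 × Fin 3 → ℝ :=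
  fun p => (1 + (-1 : ℝ) ^ (p.1 : ℕ) * ![a, b, c] p.2) / 2

abbrev Mn (η : ℝ) : Fin 2 × Fin 3 → Matrix (Fin 2) (Fin 2) ℂ :=
  fun p : Fin 2 × Fin 3 =>
          η • mub3 p + ((1 - η) * (2 : ℝ)⁻¹) • (1 : Matrix (Fin 2) (Fin 2) ℂ)

lemma detq_mem (η : ℝ) (hη : 0 < η) (a b c : ℝ) (ha : a ^ 2 = 1) (hb : b ^ 2 = 1)
    (hc : c ^ 2 = 1) : detq a b c ∈ multiPolytope (Mn η) := by
  refine ⟨?_, ?_, ?_⟩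
  · rintro ⟨i, j⟩
    fin_cases i <;> fin_cases j <;> simp [detq] <;> nlinarith
  · intro y
    simp [Fin.sum_univ_two, detq]; ring
  · intro β hβ
    have e00 := congrFun (congrFun hβ 0) 0
    have e01 := congrFun (congrFun hβ 0) 1
    have e11 := congrFun (congrFun hβ 1) 1
    simp [Fintype.sum_prod_type, Fin.sum_univ_succ, Mn, mub3, σx, σy, σz, Complex.ext_iff]
      at e00 e01 e11
    obtain ⟨ex, ey⟩ := e01
    have hx : η * (β (0, 0) - β (1, 0)) = 0 := by linarith
    have hy : η * (β (0, 1) - β (1, 1)) = 0 := by linarith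
    have hz : η * (β (0, 2) - β (1, 2)) = 0 := by linarith
    have hx := (mul_eq_zero.mp hx).resolve_left hη.ne'
    have hy := (mul_eq_zero.mp hy).resolve_left hη.ne'
    have hz := (mul_eq_zero.mp hz).resolve_left hη.ne'
    simp [Fintype.sum_prod_type, Fin.sum_univ_succ, detq]
    linear_combination (a / 2) * hx + (b / 2) * hy + (c / 2) * hz + (e00 + e11) / 2

lemma zero_classical : IsClassicalMulti (Mn 0) := by
  refine ⟨1, fun _ => 1, fun _ _ => 1 / 2, fun _ => Matrix.PosSemidef.one, by simp, fun _ => ⟨?_, ?_, ?_⟩, ?_⟩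
  · intro p; norm_num
  · intro y; norm_num
  · intro β hβ
    have e00 := congrArg Complex.re (congrFun (congrFun hβ 0) 0)
    simp [Mn, ← Finset.sum_smul, ← Finset.sum_mul, Matrix.sum_apply] at e00 ⊢
    first | exact e00 | linarith
  · intro b y; simp [Mn]

def sa : Fin 8 → ℝ := ![1, 1, 1, 1, -1, -1, -1, -1]
def sb : Fin 8 → ℝ := ![1, 1, -1, -1, 1, 1, -1, -1]
def sc : Fin 8 → ℝ := ![1, -1, 1, -1, 1, -1, 1, -1]

set_option maxHeartbeats 4000000 in
lemma pos_classical (η : ℝ) (hη : 0 < η) (h : η * Real.sqrt 3 ≤ 1) : IsClassicalMulti (Mn η) := by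
  have ha : ∀ l, sa l ^ 2 = 1 := by intro l; fin_cases l <;> simp [sa]
  have hb : ∀ l, sb l ^ 2 = 1 := by intro l; fin_cases l <;> simp [sb]
  have hc : ∀ l, sc l ^ 2 = 1 := by intro l; fin_cases l <;> simp [sc]
  refine ⟨8, fun l => (8 : ℝ)⁻¹ • (1 + η • WS (sa l) (sb l) (sc l)),
    fun l => detq (sa l) (sb l) (sc l),
    fun l => G_psd η _ _ _ hη.le h (ha l) (hb l) (hc l), ?_,
    fun l => detq_mem η hη _ _ _ (ha l) (hb l) (hc l), ?_⟩
  · ext i j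
    fin_cases i <;> fin_cases j <;>
      simp [Fin.sum_univ_eight, sa, sb, sc, WS] <;> ring
  · intro b y
    ext i j
    fin_cases b <;> fin_cases y <;> fin_cases i <;> fin_cases j <;>
      simp [Fin.sum_univ_eight, sa, sb, sc, WS, detq, Mn, mub3, σx, σy, σz] <;> ring

lemma classical_bound (η : ℝ) (h : IsClassicalMulti (Mn η)) : 3 * η ≤ Real.sqrt 3 := by
  obtain ⟨n, G, q, hG, hs, hq, hM⟩ := h
  have hc : ∀ l y, |q l (0, y) - q l (1, y)| ≤ 1 := by
    intro l y
    obtain ⟨h1, h2, -⟩ := hq l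
    have h2 := h2 y
    rw [Fin.sum_univ_two] at h2
    rw [abs_le]
    constructor <;> linarith [h1 (0, y), h1 (1, y)]
  have hb := Finset.sum_le_sum (fun l (_ : l ∈ Finset.univ) =>
    psd_bound (G l) (hG l) _ _ _ (hc l 0) (hc l 1) (hc l 2))
  have hd : ∀ y, η • ![σx, σy, σz] y = ∑ l, (q l (0, y) - q l (1, y)) • G l := by
    intro y
    simp only [sub_smul, Finset.sum_sub_distrib]
    rw [← hM, ← hM]
    simp only [Mn, mub3]
    simp
    module
  have e : ∀ y i j, (η • ![σx, σy, σz] y) i j = ∑ l, (q l (0, y) - q l (1, y)) • G l i j := by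
    intro y i j
    rw [hd, Matrix.sum_apply]; rfl
  have hx1 := congrArg Complex.re (e 0 0 1)
  have hx2 := congrArg Complex.re (e 0 1 0)
  have hy1 := congrArg Complex.im (e 1 0 1)
  have hy2 := congrArg Complex.im (e 1 1 0)
  have hz1 := congrArg Complex.re (e 2 0 0)
  have hz2 := congrArg Complex.re (e 2 1 1)
  have t1 := congrArg Complex.re (congrFun (congrFun hs 0) 0)
  have t2 := congrArg Complex.re (congrFun (congrFun hs 1) 1)
  rw [Matrix.sum_apply] at t1 t2
  simp only [Complex.re_sum, Complex.im_sum, Complex.smul_re, Complex.smul_im, smul_eq_mul]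
    at hx1 hx2 hy1 hy2 hz1 hz2 t1 t2
  simp only [Complex.add_re, Complex.sub_re, Complex.sub_im, mul_add, mul_sub,
    Finset.sum_add_distrib, Finset.sum_sub_distrib] at hb
  rw [← hx1, ← hx2, ← hy1, ← hy2, ← hz1, ← hz2, ← Finset.mul_sum, ← Finset.mul_sum, t1, t2] at hb
  simp [σx, σy, σz] at hb
  linarith

theorem three_mub_white_noise_robustness (η : ℝ) (hη : η ∈ Set.Icc (0 : ℝ) 1) :
    IsClassicalMulti
        (fun p : Fin 2 × Fin 3 =>
          η • mub3 p + ((1 - η) * (2 : ℝ)⁻¹) • (1 : Matrix (Fin 2) (Fin 2) ℂ)) ↔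
      η ≤ 1 / Real.sqrt 3 := by
  have h3 : Real.sqrt 3 ^ 2 = 3 := Real.sq_sqrt (by norm_num)
  have hp : 0 < Real.sqrt 3 := by positivity
  rw [le_div_iff₀ hp]
  constructor
  · intro h
    have := classical_bound η h
    nlinarith
  · intro h
    rcases hη.1.eq_or_lt with h0 | h0
    · subst h0; exact zero_classical
    · exact pos_classical η h0 h
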